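/- Suppose that 𝔖 is a 2,3-split system on a finite multiset 𝓜 in which every split has multiplicity 1. Then 𝔖 is compatible if and only if every subset of 𝔖 of size at most Δ(𝓜)+3 is compatible. -/

import Mathlib

open scoped Classical

/-- A split of a multiset `M`: an unordered pair of nonempty submultisets of `M`
whose multiset union is `M`. -/
def IsSplit {X : Type} (M : Multiset X) (S : Sym2 (Multiset X)) : Prop :=
  ∃ A B : Multiset X, S = s(A, B) ∧ A ≠ 0 ∧ B ≠ 0 ∧ A + B = M

/-- A split system on `M`: a multiset of splits of `M`. -/
def IsSplitSystem {X : Type} (M : Multiset X) (𝔖 : Multiset (Sym2 (Multiset X))) : Prop :=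
  ∀ S ∈ 𝔖, IsSplit M S

/-- An `M`-tree: a finite tree whose vertices are labelled by submultisets of `M`
such that (M1) the multiset union of all labels is `M`, and (M2) every vertex of
degree 1 or 2 has a nonempty label. -/
structure MTree (X : Type) (M : Multiset X) where
  n : ℕ
  G : SimpleGraph (Fin n)
  connected : G.Connected
  acyclic : G.IsAcyclic
  label : Fin n → Multiset X
  m1 : ∑ v, label v = M
  m2 : ∀ v, G.degree v = 1 ∨ G.degree v = 2 → label v ≠ 0

namespace MTree

variable {X : Type} {M : Multiset X}

/-- The part of the split induced by the edge `{u, v}` lying on the side of `u`: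
the multiset union of the labels of the vertices in the connected component of `u`
after deleting the edge `{u, v}`. -/
noncomputable def part (T : MTree X M) (u v : Fin T.n) : Multiset X :=
  ∑ w ∈ Finset.univ.filter (fun w => (T.G.deleteEdges {s(u, v)}).Reachable u w), T.label w

/-- The multiset of splits represented by an `M`-tree: the splits induced by its edges. -/
noncomputable def splits (T : MTree X M) : Multiset (Sym2 (Multiset X)) :=
  T.G.edgeFinset.val.map
    (Sym2.lift ⟨fun u v => s(T.part u v, T.part v u), fun u v => Sym2.eq_swap⟩)

end MTree

/-- A split system on `M` is compatible if some `M`-tree represents it. -/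
def Compatible {X : Type} (M : Multiset X) (𝔖 : Multiset (Sym2 (Multiset X))) : Prop :=
  ∃ T : MTree X M, T.splits = 𝔖

/-- `Δ(M) = Σ_{x ∈ X} (M(x) - 1)`. -/
def delta {X : Type} [DecidableEq X] (M : Multiset X) : ℕ :=
  ∑ x ∈ M.toFinset, (M.count x - 1)

/-- The split system `{S₁, …, Sₙ}` determined by an indexed family of ordered splits,
where split `i` has parts `P i true` and `P i false`. -/
def splitSystemOf {X : Type} {n : ℕ} (P : Fin n → Bool → Multiset X) :
    Multiset (Sym2 (Multiset X)) :=
  (Finset.univ.val : Multiset (Fin n)).map fun i => s(P i true, P i false)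

/-- The arcs of the split-containment graph `Γ(𝔖)`: its vertices are the pairs
`(i, b)` (representing the pair `(P i b, Sᵢ)` of a part of the split `Sᵢ` together
with `Sᵢ`), and there is an arc from `(i, b)` to `(j, c)` iff `i ≠ j` and
`P i b ⊊ P j c` as multisets. -/
def GammaArc {X : Type} {n : ℕ} (P : Fin n → Bool → Multiset X)
    (u v : Fin n × Bool) : Prop :=
  u.1 ≠ v.1 ∧ P u.1 u.2 < P v.1 v.2

/-- A thin subgraph of `Γ(𝔖)`: a spanning subgraph `G` of `Γ(𝔖)` such that for all
distinct `i, j` the restriction of `G` to the four vertices coming from `Sᵢ` and `Sⱼ`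
has exactly two arcs, of the form `((C,Sᵢ),(D,Sⱼ))` and `((D̄,Sⱼ),(C̄,Sᵢ))`. -/
def IsThinSubgraph {X : Type} {n : ℕ} (P : Fin n → Bool → Multiset X)
    (G : Fin n × Bool → Fin n × Bool → Prop) : Prop :=
  (∀ u v, G u v → GammaArc P u v) ∧
  ∀ i j : Fin n, i ≠ j → ∃ b c : Bool, ∀ b' c' : Bool,
    (G (i, b') (j, c') ↔ b' = b ∧ c' = c) ∧
    (G (j, c') (i, b') ↔ c' = !c ∧ b' = !b)

/-- An arc `(u, v)` of a digraph `G` is critical if the only directed path in `G`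
from `u` to `v` is the arc itself. -/
def IsCriticalArc {V : Type} (G : V → V → Prop) (u v : V) : Prop :=
  G u v ∧ ¬ ∃ w, G u w ∧ w ≠ v ∧ Relation.TransGen G w v

/-- A (thin) subgraph `G` of `Γ(𝔖)` is consistent if for every vertex `(A, Sᵢ)` of `G`,
the multiset union of the parts `B` over all vertices `(B, Sⱼ)` such that
`((B,Sⱼ),(A,Sᵢ))` is a critical arc of `G` is a submultiset of `A`. -/
def IsConsistent {X : Type} {n : ℕ} (P : Fin n → Bool → Multiset X)
    (G : Fin n × Bool → Fin n × Bool → Prop) : Prop :=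
  ∀ u : Fin n × Bool,
    (∑ w ∈ Finset.univ.filter (fun w => IsCriticalArc G w u), P w.1 w.2) ≤ P u.1 u.2

/-- A part `A` of a split `A|Ā ∈ 𝔖` is a terminal set of `𝔖` if for every split
`B|B̄` of `𝔖` other than (this occurrence of) `A|Ā`, neither `B ⊊ A` nor `B̄ ⊊ A`. -/
def IsTerminal {X : Type} [DecidableEq X] (M : Multiset X)
    (𝔖 : Multiset (Sym2 (Multiset X))) (A : Multiset X) : Prop :=
  s(A, M - A) ∈ 𝔖 ∧ ∀ T ∈ 𝔖.erase s(A, M - A), ∀ B ∈ T, ¬ B < A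

/-- A terminal set `A` of `𝔖` is a superterminal set if in addition, for every split
`B|B̄` of `𝔖` other than `A|Ā`, exactly one of `A ⊊ B`, `A ⊊ B̄` holds. -/
def IsSuperterminal {X : Type} [DecidableEq X] (M : Multiset X)
    (𝔖 : Multiset (Sym2 (Multiset X))) (A : Multiset X) : Prop :=
  IsTerminal M 𝔖 A ∧
    ∀ T ∈ 𝔖.erase s(A, M - A), ∀ B C : Multiset X, T = s(B, C) → (A < B ↔ ¬ A < C)

/-- Two splits are compatible if they have parts `A ∈ S₁`, `B ∈ S₂` with `A ∩ B = ∅`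
(multiset intersection). -/
def SplitPairCompatible {X : Type} [DecidableEq X] (S₁ S₂ : Sym2 (Multiset X)) : Prop :=
  ∃ A ∈ S₁, ∃ B ∈ S₂, A ∩ B = 0

/-- A split system is pairwise compatible if any two of its splits are compatible. -/
def PairwiseCompatible {X : Type} [DecidableEq X] (𝔖 : Multiset (Sym2 (Multiset X))) : Prop :=
  ∀ S₁ ∈ 𝔖, ∀ S₂ ∈ 𝔖.erase S₁, SplitPairCompatible S₁ S₂

/-- The size of a split `A|B` is `min {|A|, |B|}`. -/
def splitSize {X : Type} : Sym2 (Multiset X) → ℕ :=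
  Sym2.lift ⟨fun A B => min A.card B.card, fun A B => min_comm _ _⟩

/-- Isomorphism of `M`-trees: a graph isomorphism preserving the labels. -/
def MTreeIso {X : Type} {M : Multiset X} (T T' : MTree X M) : Prop :=
  ∃ φ : Fin T.n ≃ Fin T'.n,
    (∀ u v, T.G.Adj u v ↔ T'.G.Adj (φ u) (φ v)) ∧ ∀ v, T'.label (φ v) = T.label v

/-- Isomorphism of digraphs. -/
def DigraphIso {V W : Type} (R : V → V → Prop) (Q : W → W → Prop) : Prop :=
  ∃ φ : V ≃ W, ∀ a b, R a b ↔ Q (φ a) (φ b)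

/-- The digraph `D₁` on the four vertices `v = 0`, `w = 1`, `p = 2`, `q = 3`,
with arcs `(v,p)` and `(q,w)`. -/
def D1 : Fin 4 → Fin 4 → Prop := fun a b => (a = 0 ∧ b = 2) ∨ (a = 3 ∧ b = 1)

/-- The digraph `D₂` on the four vertices `v = 0`, `w = 1`, `p = 2`, `q = 3`,
with arcs `(v,p)`, `(p,w)`, `(v,q)` and `(q,w)`. -/
def D2 : Fin 4 → Fin 4 → Prop :=
  fun a b => (a = 0 ∧ b = 2) ∨ (a = 2 ∧ b = 1) ∨ (a = 0 ∧ b = 3) ∨ (a = 3 ∧ b = 1)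

/-- Isomorphism of subgraphs of `Γ(𝔖)`: a digraph isomorphism mapping each vertex
`(A, Sᵢ)` to a vertex `(B, Sⱼ)` with `A = B`. -/
def SubgraphIso {X : Type} {n : ℕ} (P : Fin n → Bool → Multiset X)
    (G G' : Fin n × Bool → Fin n × Bool → Prop) : Prop :=
  ∃ φ : Fin n × Bool ≃ Fin n × Bool,
    (∀ u v, G u v ↔ G' (φ u) (φ v)) ∧ ∀ u, P (φ u).1 (φ u).2 = P u.1 u.2

/-- The families `𝒜` (of pairs) and `ℬ` (of triples) can be packed into `M`: all of `ℬ` and the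
subfamily `U` of `𝒜` fit disjointly into `M`, and the rest of `𝒜` is matched into `ℬ` by an
injection `f` compatible with inclusion. -/
def Packable {X : Type} (M : Multiset X) (𝒜 ℬ : Finset (Multiset X)) : Prop :=
  ∃ (U : Finset (Multiset X)) (f : Multiset X → Multiset X), U ⊆ 𝒜 ∧
    (∀ A ∈ 𝒜, A ∉ U → f A ∈ ℬ ∧ A ≤ f A) ∧
    (∀ A ∈ 𝒜, A ∉ U → ∀ A' ∈ 𝒜, A' ∉ U → f A = f A' → A = A') ∧
    ∑ B ∈ ℬ, B + ∑ A ∈ U, A ≤ M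

section Packing

variable {X : Type} [DecidableEq X] {M : Multiset X} {𝒜 ℬ 𝒜' ℬ' : Finset (Multiset X)}

theorem Packable.mono (h : Packable M 𝒜 ℬ) (hA : 𝒜' ⊆ 𝒜) (hB : ℬ' ⊆ ℬ) :
    Packable M 𝒜' ℬ' := by
  obtain ⟨U, f, hU, hf, hinj, hsum⟩ := h
  refine ⟨𝒜'.filter (fun A => A ∈ U ∨ f A ∉ ℬ'), f, Finset.filter_subset _ _, ?_, ?_, ?_⟩
  · intro A hA' hAU
    simp only [Finset.mem_filter, not_and, not_or, not_not] at hAU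
    exact ⟨(hAU hA').2, (hf A (hA hA') (hAU hA').1).2⟩
  · intro A h1 h2 A' h3 h4
    simp only [Finset.mem_filter, not_and, not_or, not_not] at h2 h4
    exact hinj A (hA h1) (h2 h1).1 A' (hA h3) (h4 h3).1
  · refine le_trans ?_ hsum
    set T := 𝒜'.filter (fun A => A ∉ U ∧ f A ∉ ℬ') with hT
    have hmem : ∀ A ∈ T, A ∈ 𝒜 ∧ A ∉ U ∧ f A ∉ ℬ' := fun A h => by
      rw [hT, Finset.mem_filter] at h
      exact ⟨hA h.1, h.2⟩
    have h1 : 𝒜'.filter (fun A => A ∈ U ∨ f A ∉ ℬ') ⊆ U ∪ T := by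
      intro A h
      rw [Finset.mem_filter] at h
      by_cases hAU : A ∈ U
      · exact Finset.mem_union_left _ hAU
      · exact Finset.mem_union_right _ (Finset.mem_filter.2 ⟨h.1, hAU, h.2.resolve_left hAU⟩)
    have hdisj : Disjoint U T :=
      Finset.disjoint_left.2 fun A h h' => (hmem A h').2.1 h
    have h2 : ∑ A ∈ T, A ≤ ∑ B ∈ ℬ \ ℬ', B := by
      calc ∑ A ∈ T, A ≤ ∑ A ∈ T, f A :=
            Finset.sum_le_sum fun A h => (hf A (hmem A h).1 (hmem A h).2.1).2
        _ = ∑ B ∈ T.image f, B := by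
            rw [Finset.sum_image]
            intro A h A' h' e
            exact hinj A (hmem A h).1 (hmem A h).2.1 A' (hmem A' h').1 (hmem A' h').2.1 e
        _ ≤ ∑ B ∈ ℬ \ ℬ', B := by
            apply Finset.sum_le_sum_of_subset
            intro B hB'
            obtain ⟨A, h, rfl⟩ := Finset.mem_image.1 hB'
            exact Finset.mem_sdiff.2 ⟨(hf A (hmem A h).1 (hmem A h).2.1).1, (hmem A h).2.2⟩
    calc _ ≤ ∑ B ∈ ℬ', B + ∑ A ∈ U ∪ T, A :=
          add_le_add le_rfl (Finset.sum_le_sum_of_subset h1)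
      _ = ∑ B ∈ ℬ', B + (∑ A ∈ U, A + ∑ A ∈ T, A) := by rw [Finset.sum_union hdisj]
      _ ≤ ∑ B ∈ ℬ', B + (∑ A ∈ U, A + ∑ B ∈ ℬ \ ℬ', B) := by gcongr
      _ = ∑ B ∈ ℬ, B + ∑ A ∈ U, A := by
          rw [← Finset.sum_sdiff hB]; abel

/-- The elements occurring in the members of a family of multisets. -/
def groundSet (𝒜 : Finset (Multiset X)) : Finset X := 𝒜.biUnion Multiset.toFinset

theorem mem_groundSet {x : X} : x ∈ groundSet 𝒜 ↔ ∃ A ∈ 𝒜, x ∈ A := by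
  simp [groundSet]

theorem count_sum_eq_zero {x : X} {U : Finset (Multiset X)} (hx : x ∉ groundSet U) :
    (∑ A ∈ U, A).count x = 0 := by
  rw [Multiset.count_sum']
  refine Finset.sum_eq_zero fun A hA => Multiset.count_eq_zero.2 fun h => hx ?_
  exact mem_groundSet.2 ⟨A, hA, h⟩

theorem groundSet_mono (h : 𝒜' ⊆ 𝒜) : groundSet 𝒜' ⊆ groundSet 𝒜 :=
  Finset.biUnion_subset_biUnion_of_subset_left _ h

/-- A family of pairs with no nontrivial subfamily separated from its complement is a connected
multigraph, so it spans at most one more element than it has members. -/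
theorem card_groundSet_le (hA : ∀ A ∈ 𝒜, A.card = 2) (hne : 𝒜.Nonempty)
    (hconn : ∀ 𝒞 ⊂ 𝒜, 𝒞.Nonempty → ∃ A ∈ 𝒜 \ 𝒞, ∃ x ∈ A, x ∈ groundSet 𝒞) :
    (groundSet 𝒜).card ≤ 𝒜.card + 1 := by
  have key : ∀ k, 1 ≤ k → k ≤ 𝒜.card →
      ∃ 𝒞 ⊆ 𝒜, 𝒞.card = k ∧ (groundSet 𝒞).card ≤ k + 1 := by
    intro k hk
    induction k, hk using Nat.le_induction with
    | base =>
      intro _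
      obtain ⟨A, h⟩ := hne
      refine ⟨{A}, by simpa using h, by simp, ?_⟩
      simp only [groundSet, Finset.singleton_biUnion]
      exact (Multiset.toFinset_card_le A).trans (hA A h).le
    | succ k hk ih =>
      intro hk'
      obtain ⟨𝒞, hC, hcard, hg⟩ := ih (by omega)
      have hss : 𝒞 ⊂ 𝒜 := by
        refine hC.ssubset_of_ne ?_
        rintro rfl
        omega
      obtain ⟨A, h, x, hx, hxC⟩ := hconn 𝒞 hss (Finset.card_pos.1 (by omega))
      rw [Finset.mem_sdiff] at h
      refine ⟨insert A 𝒞, Finset.insert_subset h.1 hC, by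
        rw [Finset.card_insert_of_notMem h.2, hcard], ?_⟩
      have hsub : groundSet (insert A 𝒞) ⊆ groundSet 𝒞 ∪ (A.erase x).toFinset := by
        intro y hy
        obtain ⟨A', hA', hyA'⟩ := mem_groundSet.1 hy
        rw [Finset.mem_union]
        rcases Finset.mem_insert.1 hA' with rfl | hA'
        · by_cases hxy : y = x
          · exact Or.inl (hxy ▸ hxC)
          · right
            rw [Multiset.mem_toFinset, Multiset.mem_erase_of_ne hxy]
            exact hyA'
        · exact Or.inl (mem_groundSet.2 ⟨A', hA', hyA'⟩)
      have h1 := Finset.card_le_card hsub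
      have h2 := Finset.card_union_le (groundSet 𝒞) (A.erase x).toFinset
      have h3 := Multiset.toFinset_card_le (A.erase x)
      have h4 := Multiset.card_erase_of_mem hx
      have h5 := hA A h.1
      rw [h5] at h4
      simp only [Nat.pred_eq_sub_one] at h4
      omega
  obtain ⟨𝒞, hC, hcard, hg⟩ := key 𝒜.card (Finset.card_pos.2 hne) le_rfl
  rwa [Finset.eq_of_subset_of_card_le hC hcard.ge] at hg

theorem count_le_delta_add_one (x : X) : M.count x ≤ delta M + 1 := by
  by_cases hx : x ∈ M
  · have := Finset.single_le_sum (f := fun x => M.count x - 1) (fun _ _ => Nat.zero_le _)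
      (Multiset.mem_toFinset.2 hx)
    unfold delta
    omega
  · simp [Multiset.count_eq_zero_of_notMem hx]

theorem sum_count_le_delta_add_card {V : Finset X} (hV : ∀ x ∈ V, x ∈ M) :
    ∑ x ∈ V, M.count x ≤ delta M + V.card := by
  have h1 : ∑ x ∈ V, M.count x = ∑ x ∈ V, (M.count x - 1) + V.card := by
    rw [Finset.card_eq_sum_ones, ← Finset.sum_add_distrib]
    refine Finset.sum_congr rfl fun x hx => ?_
    have := Multiset.one_le_count_iff_mem.2 (hV x hx)
    omega
  rw [h1]
  gcongr
  exact Finset.sum_le_sum_of_subset fun x hx => Multiset.mem_toFinset.2 (hV x hx)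

/-- The family is not packable, but all families obtained by removing a member are. -/
def MinUnpackable (M : Multiset X) (𝒜 ℬ : Finset (Multiset X)) : Prop :=
  ¬ Packable M 𝒜 ℬ ∧ ∀ 𝒜' ⊆ 𝒜, ∀ ℬ' ⊆ ℬ, 𝒜'.card + ℬ'.card < 𝒜.card + ℬ.card →
    Packable M 𝒜' ℬ'

theorem exists_minUnpackable (h : ¬ Packable M 𝒜 ℬ) :
    ∃ 𝒜' ⊆ 𝒜, ∃ ℬ' ⊆ ℬ, MinUnpackable M 𝒜' ℬ' := by
  induction hn : 𝒜.card + ℬ.card using Nat.strong_induction_on generalizing 𝒜 ℬ with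
  | _ n ih =>
    by_cases hmin : ∀ 𝒜' ⊆ 𝒜, ∀ ℬ' ⊆ ℬ, 𝒜'.card + ℬ'.card < 𝒜.card + ℬ.card →
        Packable M 𝒜' ℬ'
    · exact ⟨𝒜, subset_rfl, ℬ, subset_rfl, h, hmin⟩
    · push Not at hmin
      obtain ⟨𝒜', hA, ℬ', hB, hlt, hP⟩ := hmin
      obtain ⟨𝒜'', hA', ℬ'', hB', hm⟩ := ih _ (hn ▸ hlt) hP rfl
      exact ⟨𝒜'', hA'.trans hA, ℬ'', hB'.trans hB, hm⟩

namespace MinUnpackable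

theorem card_le_of_empty (h : MinUnpackable M ∅ ℬ) : ℬ.card ≤ delta M + 3 := by
  obtain ⟨hnot, hmin⟩ := h
  have hnle : ¬ ∑ B ∈ ℬ, B ≤ M := fun hle =>
    hnot ⟨∅, id, subset_rfl, by simp, by simp, by simpa using hle⟩
  rw [Multiset.le_iff_count] at hnle
  push Not at hnle
  obtain ⟨x, hx⟩ := hnle
  rw [Multiset.count_sum'] at hx
  have herase : ∀ B ∈ ℬ, ∑ B' ∈ ℬ.erase B, B'.count x ≤ M.count x := by
    intro B hB
    obtain ⟨U, f, hU, -, -, hsum⟩ := hmin ∅ subset_rfl (ℬ.erase B) (Finset.erase_subset _ _)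
      (by have := Finset.card_erase_lt_of_mem hB; omega)
    rw [Finset.subset_empty.1 hU, Finset.sum_empty, add_zero] at hsum
    rw [← Multiset.count_sum']
    exact Multiset.count_le_of_le _ hsum
  have hpos : ∀ B ∈ ℬ, 1 ≤ B.count x := by
    intro B hB
    have := herase B hB
    rw [← Finset.add_sum_erase _ _ hB] at hx
    omega
  rcases ℬ.eq_empty_or_nonempty with rfl | ⟨B, hB⟩
  · simp
  have h1 := herase B hB
  have h2 : (ℬ.erase B).card ≤ ∑ B' ∈ ℬ.erase B, B'.count x := by
    rw [Finset.card_eq_sum_ones]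
    exact Finset.sum_le_sum fun B' h => hpos B' (Finset.mem_of_mem_erase h)
  have h3 := count_le_delta_add_one (M := M) x
  rw [Finset.card_erase_of_mem hB] at h2
  omega

theorem sum_triples_le (h : MinUnpackable M 𝒜 ℬ) (hne : 𝒜.Nonempty) : ∑ B ∈ ℬ, B ≤ M := by
  obtain ⟨U, f, hU, -, -, hsum⟩ := h.2 ∅ (Finset.empty_subset _) ℬ subset_rfl
    (by have := Finset.card_pos.2 hne; simp [this])
  rwa [Finset.subset_empty.1 hU, Finset.sum_empty, add_zero] at hsum

theorem exists_mem_triple (h : MinUnpackable M 𝒜 ℬ) (hne : 𝒜.Nonempty) {B : Multiset X}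
    (hB : B ∈ ℬ) : ∃ x ∈ B, x ∈ groundSet 𝒜 := by
  by_contra! hcon
  have hle := h.sum_triples_le hne
  obtain ⟨U, f, hU, hf, hinj, hsum⟩ := h.2 𝒜 subset_rfl (ℬ.erase B) (Finset.erase_subset _ _)
    (by have := Finset.card_erase_lt_of_mem hB; omega)
  refine h.1 ⟨U, f, hU, fun A hA hAU => ⟨Finset.mem_of_mem_erase (hf A hA hAU).1,
    (hf A hA hAU).2⟩, hinj, Multiset.le_iff_count.2 fun x => ?_⟩
  by_cases hx : x ∈ groundSet 𝒜
  · have h0 : B.count x = 0 := Multiset.count_eq_zero.2 fun h' => hcon x h' hx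
    have := Multiset.count_le_of_le x hsum
    rw [← Finset.add_sum_erase _ _ hB]
    simp only [Multiset.count_add] at this ⊢
    omega
  · rw [Multiset.count_add, count_sum_eq_zero fun h' => hx (groundSet_mono hU h'), add_zero]
    exact Multiset.count_le_of_le x hle

theorem exists_other_pair (h : MinUnpackable M 𝒜 ℬ) {A B : Multiset X}
    (hA : A ∈ 𝒜) (hB : B ∈ ℬ) (hAB : A ≤ B) : ∃ A' ∈ 𝒜, A' ≠ A ∧ A' ≤ B := by
  by_contra! hcon
  obtain ⟨U, f, hU, hf, hinj, hsum⟩ := h.2 (𝒜.erase A) (Finset.erase_subset _ _) ℬ subset_rfl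
    (by have := Finset.card_erase_lt_of_mem hA; omega)
  have hne : ∀ A' ∈ 𝒜, A' ∉ U → A' ≠ A → f A' ≠ B := fun A' hA' hU' hn he =>
    hcon A' hA' hn (he ▸ (hf A' (Finset.mem_erase.2 ⟨hn, hA'⟩) hU').2)
  refine h.1 ⟨U, Function.update f A B, hU.trans (Finset.erase_subset _ _), ?_, ?_, hsum⟩
  · intro A' hA' hU'
    by_cases hn : A' = A
    · subst hn
      simpa using ⟨hB, hAB⟩
    · rw [Function.update_of_ne hn]
      exact hf A' (Finset.mem_erase.2 ⟨hn, hA'⟩) hU'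
  · intro A₁ h₁ hU₁ A₂ h₂ hU₂ he
    by_cases hn₁ : A₁ = A <;> by_cases hn₂ : A₂ = A
    · rw [hn₁, hn₂]
    · subst hn₁
      rw [Function.update_self, Function.update_of_ne hn₂] at he
      exact absurd he.symm (hne A₂ h₂ hU₂ hn₂)
    · subst hn₂
      rw [Function.update_self, Function.update_of_ne hn₁] at he
      exact absurd he (hne A₁ h₁ hU₁ hn₁)
    · rw [Function.update_of_ne hn₁, Function.update_of_ne hn₂] at he
      exact hinj A₁ (Finset.mem_erase.2 ⟨hn₁, h₁⟩) hU₁ A₂ (Finset.mem_erase.2 ⟨hn₂, h₂⟩) hU₂ he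

theorem exists_adjacent (h : MinUnpackable M 𝒜 ℬ) (hA : ∀ A ∈ 𝒜, A.card = 2)
    (hB : ∀ B ∈ ℬ, B.card = 3) {𝒞 : Finset (Multiset X)} (hC : 𝒞 ⊂ 𝒜) (hne : 𝒞.Nonempty) :
    ∃ A ∈ 𝒜 \ 𝒞, ∃ x ∈ A, x ∈ groundSet 𝒞 := by
  by_contra! hcon
  have hsplit := Finset.card_sdiff_add_card_eq_card hC.subset
  have hlt := Finset.card_lt_card hC
  have hpos := Finset.card_pos.2 hne
  obtain ⟨U, f, hU, hf, hinj, hsum⟩ := h.2 𝒞 hC.subset ℬ subset_rfl (by omega)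
  obtain ⟨U', f', hU', hf', hinj', hsum'⟩ := h.2 (𝒜 \ 𝒞) Finset.sdiff_subset ℬ subset_rfl
    (by omega)
  have hcross : ∀ A ∈ 𝒞, ∀ A' ∈ 𝒜, A' ∉ 𝒞 → ∀ B ∈ ℬ, A ≤ B → A' ≤ B → False := by
    intro A h₁ A' h₂ h₃ B h₄ h₅ h₆
    have hle : A + A' ≤ B := by
      have hd : Disjoint A A' := Multiset.disjoint_left.2 fun {x} hx hx' =>
        hcon A' (Finset.mem_sdiff.2 ⟨h₂, h₃⟩) x hx' (mem_groundSet.2 ⟨A, h₁, hx⟩)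
      rw [Multiset.add_eq_union_iff_disjoint.2 hd]
      exact Multiset.union_le h₅ h₆
    have := Multiset.card_le_card hle
    rw [Multiset.card_add, hA A (hC.subset h₁), hA A' h₂, hB B h₄] at this
    omega
  have hnU : ∀ A ∈ 𝒞, A ∉ U ∪ U' → A ∉ U := fun A _ h' h'' => h' (Finset.mem_union_left _ h'')
  have hnU' : ∀ A, A ∉ U ∪ U' → A ∉ U' := fun A h' h'' => h' (Finset.mem_union_right _ h'')
  refine h.1 ⟨U ∪ U', fun A => if A ∈ 𝒞 then f A else f' A,
    Finset.union_subset (hU.trans hC.subset) (hU'.trans Finset.sdiff_subset), ?_, ?_, ?_⟩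
  · intro A h₁ h₂
    by_cases hAC : A ∈ 𝒞
    · simpa [hAC] using hf A hAC (hnU A hAC h₂)
    · simpa [hAC] using hf' A (Finset.mem_sdiff.2 ⟨h₁, hAC⟩) (hnU' A h₂)
  · intro A₁ h₁ hn₁ A₂ h₂ hn₂ he
    by_cases hc₁ : A₁ ∈ 𝒞 <;> by_cases hc₂ : A₂ ∈ 𝒞 <;> simp only [hc₁, hc₂, if_true, if_false] at he
    · exact hinj A₁ hc₁ (hnU _ hc₁ hn₁) A₂ hc₂ (hnU _ hc₂ hn₂) he
    · have e₁ := hf A₁ hc₁ (hnU _ hc₁ hn₁)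
      have e₂ := hf' A₂ (Finset.mem_sdiff.2 ⟨h₂, hc₂⟩) (hnU' A₂ hn₂)
      exact (hcross A₁ hc₁ A₂ h₂ hc₂ _ e₁.1 e₁.2 (he ▸ e₂.2)).elim
    · have e₁ := hf' A₁ (Finset.mem_sdiff.2 ⟨h₁, hc₁⟩) (hnU' A₁ hn₁)
      have e₂ := hf A₂ hc₂ (hnU _ hc₂ hn₂)
      exact (hcross A₂ hc₂ A₁ h₁ hc₁ _ e₂.1 e₂.2 (he ▸ e₁.2)).elim
    · exact hinj' A₁ (Finset.mem_sdiff.2 ⟨h₁, hc₁⟩) (hnU' _ hn₁) A₂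
        (Finset.mem_sdiff.2 ⟨h₂, hc₂⟩) (hnU' _ hn₂) he
  · have hd : Disjoint U U' := Finset.disjoint_left.2 fun A h₁ h₂ =>
      (Finset.mem_sdiff.1 (hU' h₂)).2 (hU h₁)
    rw [Finset.sum_union hd]
    refine Multiset.le_iff_count.2 fun x => ?_
    have e₁ := Multiset.count_le_of_le x hsum
    have e₂ := Multiset.count_le_of_le x hsum'
    by_cases hx : x ∈ groundSet 𝒞
    · have : x ∉ groundSet U' := fun h' => by
        obtain ⟨A, h₁, h₂⟩ := mem_groundSet.1 h'
        exact hcon A (hU' h₁) x h₂ hx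
      have := count_sum_eq_zero this
      simp only [Multiset.count_add] at e₁ e₂ ⊢
      omega
    · have := count_sum_eq_zero fun h' => hx (groundSet_mono hU h')
      simp only [Multiset.count_add] at e₁ e₂ ⊢
      omega

/-- Two distinct pairs inside a triple cover it. -/
theorem mem_of_two_pairs {A A' B : Multiset X} (hA : A.card = 2) (hA' : A'.card = 2)
    (hB : B.card = 3) (hne : A' ≠ A) (hAB : A ≤ B) (hAB' : A' ≤ B) {x : X} (hx : x ∈ B) :
    x ∈ A ∨ x ∈ A' := by
  by_contra! hcon
  have key : ∀ C : Multiset X, C.card = 2 → C ≤ B → x ∉ C → C = B.erase x := by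
    intro C hC hCB hxC
    refine Multiset.eq_of_le_of_card_le ?_ ?_
    · rw [← Multiset.erase_of_notMem hxC]
      exact Multiset.erase_le_erase x hCB
    · rw [Multiset.card_erase_of_mem hx, hB, hC]
      rfl
  exact hne ((key A' hA' hAB' hcon.2).trans (key A hA hAB hcon.1).symm)

theorem card_le (h : MinUnpackable M 𝒜 ℬ) (hA : ∀ A ∈ 𝒜, A.card = 2)
    (hB : ∀ B ∈ ℬ, B.card = 3) (hAM : ∀ A ∈ 𝒜, A ≤ M) :
    𝒜.card + ℬ.card ≤ delta M + 3 := by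
  rcases 𝒜.eq_empty_or_nonempty with rfl | hne
  · simpa using h.card_le_of_empty
  have hV := card_groundSet_le hA hne fun 𝒞 hC hCne => h.exists_adjacent hA hB hC hCne
  have hcap := sum_count_le_delta_add_card (M := M) (V := groundSet 𝒜) fun x hx => by
    obtain ⟨A, h₁, h₂⟩ := mem_groundSet.1 hx
    exact Multiset.mem_of_le (hAM A h₁) h₂
  obtain ⟨A₀, hA₀⟩ := id hne
  have hcard₀ := Finset.card_erase_add_one hA₀
  obtain ⟨U, f, hU, hf, hinj, hsum⟩ := h.2 (𝒜.erase A₀) (Finset.erase_subset _ _) ℬ subset_rfl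
    (by omega)
  set N := (𝒜.erase A₀ \ U).image f with hN
  have hNcard : N.card + U.card = (𝒜.erase A₀).card := by
    rw [hN, Finset.card_image_of_injOn, Finset.card_sdiff_add_card_eq_card hU]
    intro A₁ h₁ A₂ h₂ he
    have h₁' := Finset.mem_sdiff.1 h₁
    have h₂' := Finset.mem_sdiff.1 h₂
    exact hinj A₁ h₁'.1 h₁'.2 A₂ h₂'.1 h₂'.2 he
  have hNB : N ⊆ ℬ := by
    intro B hB
    obtain ⟨A, h₁, rfl⟩ := Finset.mem_image.1 hB
    have h₁' := Finset.mem_sdiff.1 h₁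
    exact (hf A h₁'.1 h₁'.2).1
  set w : Multiset X → ℕ := fun C => ∑ x ∈ groundSet 𝒜, C.count x with hw
  have hw_full : ∀ C : Multiset X, (∀ x ∈ C, x ∈ groundSet 𝒜) → w C = C.card :=
    fun C hC => Multiset.sum_count_eq_card hC
  have hwU : ∀ A ∈ U, w A = 2 := by
    intro A h₁
    have h₂ : A ∈ 𝒜 := Finset.mem_of_mem_erase (hU h₁)
    rw [hw_full A fun x hx => mem_groundSet.2 ⟨A, h₂, hx⟩, hA A h₂]
  have hwB : ∀ B ∈ ℬ, 1 ≤ w B := by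
    intro B h₁
    obtain ⟨x, hx, hxV⟩ := h.exists_mem_triple hne h₁
    exact (Multiset.one_le_count_iff_mem.2 hx).trans
      (Finset.single_le_sum (f := fun x => B.count x) (fun _ _ => Nat.zero_le _) hxV)
  have hwN : ∀ B ∈ N, w B = 3 := by
    intro B h₁
    have hBB := hNB h₁
    obtain ⟨A, h₂, rfl⟩ := Finset.mem_image.1 h₁
    have h₂' := Finset.mem_sdiff.1 h₂
    have hA𝒜 := Finset.mem_of_mem_erase h₂'.1
    have hAf := (hf A h₂'.1 h₂'.2).2
    obtain ⟨A', h₃, h₄, h₅⟩ := h.exists_other_pair hA𝒜 hBB hAf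
    rw [hw_full _ fun x hx => ?_, hB _ hBB]
    rcases mem_of_two_pairs (hA A hA𝒜) (hA A' h₃) (hB _ hBB) h₄ hAf h₅ hx with hx | hx
    · exact mem_groundSet.2 ⟨A, hA𝒜, hx⟩
    · exact mem_groundSet.2 ⟨A', h₃, hx⟩
  have htotal : ∑ B ∈ ℬ, w B + ∑ A ∈ U, w A ≤ ∑ x ∈ groundSet 𝒜, M.count x := by
    simp only [hw]
    rw [Finset.sum_comm, Finset.sum_comm (s := U), ← Finset.sum_add_distrib]
    refine Finset.sum_le_sum fun x _ => ?_
    rw [← Multiset.count_sum', ← Multiset.count_sum', ← Multiset.count_add]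
    exact Multiset.count_le_of_le x hsum
  have hsumU : ∑ A ∈ U, w A = U.card * 2 := by
    rw [Finset.sum_congr rfl hwU, Finset.sum_const, smul_eq_mul]
  have hsumN : ∑ B ∈ N, w B = N.card * 3 := by
    rw [Finset.sum_congr rfl hwN, Finset.sum_const, smul_eq_mul]
  have hsumB : (ℬ \ N).card ≤ ∑ B ∈ ℬ \ N, w B := by
    rw [Finset.card_eq_sum_ones]
    exact Finset.sum_le_sum fun B h' => hwB B (Finset.mem_sdiff.1 h').1
  have hsplit := Finset.sum_sdiff (f := w) hNB
  have hsplit' := Finset.card_sdiff_add_card_eq_card hNB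
  omega

end MinUnpackable

theorem packable_of_small (hA : ∀ A ∈ 𝒜, A.card = 2) (hB : ∀ B ∈ ℬ, B.card = 3)
    (hAM : ∀ A ∈ 𝒜, A ≤ M)
    (h : ∀ 𝒜' ⊆ 𝒜, ∀ ℬ' ⊆ ℬ, 𝒜'.card + ℬ'.card ≤ delta M + 3 → Packable M 𝒜' ℬ') :
    Packable M 𝒜 ℬ := by
  by_contra hnot
  obtain ⟨𝒜', hA', ℬ', hB', hmin⟩ := exists_minUnpackable hnot
  exact hmin.1 (h 𝒜' hA' ℬ' hB' (hmin.card_le (fun A h' => hA A (hA' h'))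
    (fun B h' => hB B (hB' h')) fun A h' => hAM A (hA' h')))

end Packing

section TreeSides

variable {V : Type} {G : SimpleGraph V} {u v u' v' w : V}

theorem reachable_deleteEdge_or (hG : G.Connected) (u v w : V) :
    (G.deleteEdges {s(u, v)}).Reachable u w ∨ (G.deleteEdges {s(u, v)}).Reachable v w := by
  have h := (SimpleGraph.reachable_iff_reflTransGen u w).1 (hG.preconnected u w)
  induction h with
  | refl => exact Or.inl (SimpleGraph.Reachable.refl _)
  | @tail a b _ hab ih =>
    by_cases he : s(a, b) = s(u, v)
    · rcases Sym2.eq_iff.1 he with ⟨-, rfl⟩ | ⟨-, rfl⟩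
      · exact Or.inr (SimpleGraph.Reachable.refl _)
      · exact Or.inl (SimpleGraph.Reachable.refl _)
    · have : (G.deleteEdges {s(u, v)}).Reachable a b :=
        SimpleGraph.Adj.reachable (by simpa [SimpleGraph.deleteEdges_adj, hab] using he)
      exact ih.imp (fun h => h.trans this) fun h => h.trans this

theorem not_reachable_deleteEdge (hG : G.IsAcyclic) (h : G.Adj u v) :
    ¬ ((G.deleteEdges {s(u, v)}).Reachable u w ∧ (G.deleteEdges {s(u, v)}).Reachable v w) := by
  rintro ⟨h₁, h₂⟩
  exact SimpleGraph.isBridge_iff.1 (SimpleGraph.isAcyclic_iff_forall_adj_isBridge.1 hG h)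
    (h₁.trans h₂.symm)

/-- A side of one edge that misses an end of another edge is connected after deleting the
latter. -/
theorem reachable_deleteEdge_of_notMem
    (hu' : ¬ (G.deleteEdges {s(u, v)}).Reachable u u')
    (hw : (G.deleteEdges {s(u, v)}).Reachable u w) :
    (G.deleteEdges {s(u', v')}).Reachable u w := by
  have h := (SimpleGraph.reachable_iff_reflTransGen u w).1 hw
  clear hw
  induction h with
  | refl => exact SimpleGraph.Reachable.refl _
  | @tail a b ha hab ih =>
    refine ih.trans (SimpleGraph.Adj.reachable ?_)
    have ha' := (SimpleGraph.reachable_iff_reflTransGen u a).2 ha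
    have hb' := ha'.trans hab.reachable
    rw [SimpleGraph.deleteEdges_adj] at hab ⊢
    refine ⟨hab.1, fun he => hu' ?_⟩
    rcases Sym2.eq_iff.1 (Set.mem_singleton_iff.1 he) with ⟨rfl, -⟩ | ⟨-, rfl⟩
    · exact ha'
    · exact hb'

/-- Sides of edges of a tree are disjoint, nested or covering. -/
theorem sides_laminar (hc : G.Connected) (ha : G.IsAcyclic) (h : G.Adj u v) (h' : G.Adj u' v')
    (hne : s(u, v) ≠ s(u', v')) :
    let W : V → Prop := fun w => (G.deleteEdges {s(u, v)}).Reachable u w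
    let W' : V → Prop := fun w => (G.deleteEdges {s(u', v')}).Reachable u' w
    (∀ w, ¬ (W w ∧ W' w)) ∨ (∀ w, W w → W' w) ∨ (∀ w, W' w → W w) ∨ ∀ w, W w ∨ W' w := by
  intro W W'
  have hside : ∀ a, W' a ∨ (∀ w, (G.deleteEdges {s(u', v')}).Reachable a w → ¬ W' w) := by
    intro a
    by_cases h₁ : W' a
    · exact Or.inl h₁
    · exact Or.inr fun w h₂ h₃ => h₁ (h₃.trans h₂.symm)
  have hadj : (G.deleteEdges {s(u, v)}).Reachable u' v' :=
    SimpleGraph.Adj.reachable (by simpa [SimpleGraph.deleteEdges_adj, h'] using hne.symm)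
  by_cases hu' : W u'
  · have hv : ¬ (G.deleteEdges {s(v, u)}).Reachable v u' := by
      rw [Sym2.eq_swap]
      exact fun h₁ => not_reachable_deleteEdge ha h ⟨hu', h₁⟩
    have hconn : ∀ w, ¬ W w → (G.deleteEdges {s(u', v')}).Reachable v w := by
      intro w hw
      refine reachable_deleteEdge_of_notMem hv ?_
      rw [Sym2.eq_swap]
      exact (reachable_deleteEdge_or hc u v w).resolve_left hw
    rcases hside v with h₁ | h₁
    · refine Or.inr (Or.inr (Or.inr fun w => ?_))
      by_cases hw : W w
      · exact Or.inl hw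
      · exact Or.inr (SimpleGraph.Reachable.trans h₁ (hconn w hw))
    · refine Or.inr (Or.inr (Or.inl fun w hw' => ?_))
      by_contra hw
      exact h₁ w (hconn w hw) hw'
  · have hconn : ∀ w, W w → (G.deleteEdges {s(u', v')}).Reachable u w := fun w hw =>
      reachable_deleteEdge_of_notMem hu' hw
    rcases hside u with h₁ | h₁
    · exact Or.inr (Or.inl fun w hw => SimpleGraph.Reachable.trans h₁ (hconn w hw))
    · exact Or.inl fun w hw => h₁ w (hconn w hw.1) hw.2

end TreeSides

namespace MTree

variable {X : Type} {M : Multiset X}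

/-- The vertices on the side of `u` of the edge `{u, v}`. -/
noncomputable def side (T : MTree X M) (u v : Fin T.n) : Finset (Fin T.n) :=
  Finset.univ.filter fun w => (T.G.deleteEdges {s(u, v)}).Reachable u w

theorem part_eq_sum_side (T : MTree X M) (u v : Fin T.n) :
    T.part u v = ∑ w ∈ T.side u v, T.label w := rfl

theorem part_add_part (T : MTree X M) {u v : Fin T.n} (h : T.G.Adj u v) :
    T.part u v + T.part v u = M := by
  have hcompl : T.side v u = (T.side u v)ᶜ := by
    ext w
    simp only [side, Finset.mem_compl, Finset.mem_filter, Finset.mem_univ, true_and]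
    rw [Sym2.eq_swap]
    have h₁ := reachable_deleteEdge_or T.connected u v w
    have h₂ := not_reachable_deleteEdge (w := w) T.acyclic h
    tauto
  rw [part_eq_sum_side, part_eq_sum_side, hcompl, Finset.sum_add_sum_compl, T.m1]

theorem exists_adj_of_mem_splits (T : MTree X M) {C D : Multiset X} (h : s(C, D) ∈ T.splits) :
    ∃ u v, T.G.Adj u v ∧ T.part u v = C := by
  obtain ⟨e, he, heq⟩ := Multiset.mem_map.1 h
  induction e using Sym2.ind with
  | _ u v =>
    have hadj : T.G.Adj u v := by simpa using he
    rcases Sym2.eq_iff.1 heq with ⟨h₁, -⟩ | ⟨-, h₁⟩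
    · exact ⟨u, v, hadj, h₁⟩
    · exact ⟨v, u, hadj.symm, h₁⟩

end MTree

/-- The split of `M` with parts `C` and `M - C`. -/
noncomputable def splitOf {X : Type} (M C : Multiset X) : Sym2 (Multiset X) := s(C, M - C)

/-- The hypotheses on small sides of a 2,3-split system: they make up a family of pairs and a
family of triples inside `M`, none exceeds half of `M`, and no two are complementary. -/
structure SmallSides {X : Type} (M : Multiset X) (𝒜 ℬ : Finset (Multiset X)) : Prop where
  card_pair : ∀ A ∈ 𝒜, A.card = 2
  card_triple : ∀ B ∈ ℬ, B.card = 3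
  le_of_mem : ∀ C, C ∈ 𝒜 ∨ C ∈ ℬ → C ≤ M
  two_mul_card_le : ∀ C, C ∈ 𝒜 ∨ C ∈ ℬ → 2 * C.card ≤ M.card
  eq_of_add_eq : ∀ C C', C ∈ 𝒜 ∨ C ∈ ℬ → C' ∈ 𝒜 ∨ C' ∈ ℬ → C + C' = M → C = C'

namespace SmallSides

variable {X : Type} {M : Multiset X} {𝒜 ℬ 𝒜' ℬ' : Finset (Multiset X)}

theorem mono (h : SmallSides M 𝒜 ℬ) (hA : 𝒜' ⊆ 𝒜) (hB : ℬ' ⊆ ℬ) : SmallSides M 𝒜' ℬ' where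
  le_of_mem C h' := h.le_of_mem C (h'.imp (@hA C) (@hB C))
  card_pair A h' := h.card_pair A (hA h')
  card_triple B h' := h.card_triple B (hB h')
  two_mul_card_le C h' := h.two_mul_card_le C (h'.imp (@hA C) (@hB C))
  eq_of_add_eq C C' h₁ h₂ := h.eq_of_add_eq C C' (h₁.imp (@hA C) (@hB C))
    (h₂.imp (@hA C') (@hB C'))

theorem packable_of_mtree (h : SmallSides M 𝒜 ℬ) (T : MTree X M)
    (hT : ∀ C, C ∈ 𝒜 ∨ C ∈ ℬ → splitOf M C ∈ T.splits) : Packable M 𝒜 ℬ := by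
  have hedge : ∀ C, ∃ p : Fin T.n × Fin T.n, C ∈ 𝒜 ∨ C ∈ ℬ →
      T.G.Adj p.1 p.2 ∧ T.part p.1 p.2 = C := by
    intro C
    have : Nonempty (Fin T.n) := T.connected.nonempty
    by_cases hC : C ∈ 𝒜 ∨ C ∈ ℬ
    · obtain ⟨u, v, h₁, h₂⟩ := T.exists_adj_of_mem_splits (hT C hC)
      exact ⟨(u, v), fun _ => ⟨h₁, h₂⟩⟩
    · exact ⟨(Classical.arbitrary _, Classical.arbitrary _), fun h' => absurd h' hC⟩
  choose p hp using hedge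
  set W : Multiset X → Finset (Fin T.n) := fun C => T.side (p C).1 (p C).2 with hW
  have hsumW : ∀ C, C ∈ 𝒜 ∨ C ∈ ℬ → ∑ w ∈ W C, T.label w = C := fun C hC => (hp C hC).2
  have hmono : ∀ C s, C ∈ 𝒜 ∨ C ∈ ℬ → s ⊆ W C → ∑ w ∈ s, T.label w ≤ C := by
    intro C s hC hs
    calc _ ≤ ∑ w ∈ W C, T.label w := Finset.sum_le_sum_of_subset hs
      _ = C := hsumW C hC
  have hlam : ∀ C C', C ∈ 𝒜 ∨ C ∈ ℬ → C' ∈ 𝒜 ∨ C' ∈ ℬ → C ≠ C' → C.card ≤ C'.card →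
      Disjoint (W C) (W C') ∨ (W C ⊆ W C' ∧ C.card < C'.card) := by
    intro C C' hC hC' hne hle
    have hedges : s((p C).1, (p C).2) ≠ s((p C').1, (p C').2) := by
      intro he
      rcases Sym2.eq_iff.1 he with ⟨h₁, h₂⟩ | ⟨h₁, h₂⟩
      · exact hne ((hp C hC).2.symm.trans (by rw [h₁, h₂]; exact (hp C' hC').2))
      · refine hne (h.eq_of_add_eq C C' hC hC' ?_)
        have := T.part_add_part (hp C hC).1
        rwa [(hp C hC).2, ← h₁.symm, ← h₂.symm, (hp C' hC').2] at this
    have hdisj : ∀ D D', (∀ w, ¬ (w ∈ W D ∧ w ∈ W D')) → Disjoint (W D) (W D') :=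
      fun D D' h' => Finset.disjoint_left.2 fun w h₁ h₂ => h' w ⟨h₁, h₂⟩
    have hlam := sides_laminar T.connected T.acyclic (hp C hC).1 (hp C' hC').1 hedges
    have hmem : ∀ D w, (T.G.deleteEdges {s((p D).1, (p D).2)}).Reachable (p D).1 w ↔ w ∈ W D := by
      intro D w
      simp [hW, MTree.side]
    simp only [hmem] at hlam
    rcases hlam with h₁ | h₁ | h₁ | h₁
    · exact Or.inl (hdisj _ _ h₁)
    · refine Or.inr ⟨h₁, lt_of_le_of_ne hle fun he => hne ?_⟩
      refine Multiset.eq_of_le_of_card_le ?_ he.ge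
      rw [← hsumW C hC]
      exact hmono C' _ hC' h₁
    · refine absurd ?_ hne.symm
      refine Multiset.eq_of_le_of_card_le ?_ hle
      rw [← hsumW C' hC']
      exact hmono C _ hC h₁
    · refine absurd (h.eq_of_add_eq C C' hC hC' (Multiset.eq_of_le_of_card_le ?_ ?_).symm) hne
      · have hun : W C ∪ W C' = Finset.univ := by
          ext w
          simpa using h₁ w
        calc M = ∑ w ∈ W C ∪ W C', T.label w := by rw [hun, T.m1]
          _ ≤ ∑ w ∈ W C ∪ W C', T.label w + ∑ w ∈ W C ∩ W C', T.label w := le_self_add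
          _ = C + C' := by rw [Finset.sum_union_inter, hsumW C hC, hsumW C' hC']
      · have := h.two_mul_card_le C hC
        have := h.two_mul_card_le C' hC'
        rw [Multiset.card_add]
        omega
  have hpairs : ∀ A ∈ 𝒜, ∀ A' ∈ 𝒜, A ≠ A' → Disjoint (W A) (W A') := by
    intro A h₁ A' h₂ hne
    have e₁ := h.card_pair A h₁
    have e₂ := h.card_pair A' h₂
    rcases hlam A A' (Or.inl h₁) (Or.inl h₂) hne (by omega) with h' | h'
    · exact h'
    · omega
  have htriples : ∀ B ∈ ℬ, ∀ B' ∈ ℬ, B ≠ B' → Disjoint (W B) (W B') := by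
    intro B h₁ B' h₂ hne
    have e₁ := h.card_triple B h₁
    have e₂ := h.card_triple B' h₂
    rcases hlam B B' (Or.inr h₁) (Or.inr h₂) hne (by omega) with h' | h'
    · exact h'
    · omega
  have hmixed : ∀ A ∈ 𝒜, ∀ B ∈ ℬ, ¬ W A ⊆ W B → Disjoint (W A) (W B) := by
    intro A h₁ B h₂ hn
    have e₁ := h.card_pair A h₁
    have e₂ := h.card_triple B h₂
    refine (hlam A B (Or.inl h₁) (Or.inr h₂) ?_ (by omega)).resolve_right fun h' => hn h'.1
    rintro rfl
    omega
  have hex : ∀ A, ∃ B, (∃ B ∈ ℬ, W A ⊆ W B) → B ∈ ℬ ∧ W A ⊆ W B := by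
    intro A
    by_cases h' : ∃ B ∈ ℬ, W A ⊆ W B
    · obtain ⟨B, h₁, h₂⟩ := h'
      exact ⟨B, fun _ => ⟨h₁, h₂⟩⟩
    · exact ⟨A, fun h'' => absurd h'' h'⟩
  choose f hf using hex
  have hmatched : ∀ A ∈ 𝒜, A ∉ 𝒜.filter (fun A => ¬ ∃ B ∈ ℬ, W A ⊆ W B) →
      f A ∈ ℬ ∧ W A ⊆ W (f A) := by
    intro A h₁ h₂
    rw [Finset.mem_filter, not_and, not_not] at h₂
    exact hf A (h₂ h₁)
  refine ⟨𝒜.filter (fun A => ¬ ∃ B ∈ ℬ, W A ⊆ W B), f, Finset.filter_subset _ _, ?_, ?_, ?_⟩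
  · intro A h₁ h₂
    obtain ⟨h₃, h₄⟩ := hmatched A h₁ h₂
    refine ⟨h₃, ?_⟩
    conv_lhs => rw [← hsumW A (Or.inl h₁)]
    exact hmono _ _ (Or.inr h₃) h₄
  · intro A h₁ h₂ A' h₃ h₄ he
    by_contra hne
    obtain ⟨h₅, h₆⟩ := hmatched A h₁ h₂
    obtain ⟨-, h₈⟩ := hmatched A' h₃ h₄
    have hle := hmono (f A) (W A ∪ W A') (Or.inr h₅) (Finset.union_subset h₆ (he ▸ h₈))
    rw [Finset.sum_union (hpairs A h₁ A' h₃ hne), hsumW A (Or.inl h₁),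
      hsumW A' (Or.inl h₃)] at hle
    have := Multiset.card_le_card hle
    rw [Multiset.card_add, h.card_pair A h₁, h.card_pair A' h₃, h.card_triple _ h₅] at this
    omega
  · set U := 𝒜.filter (fun A => ¬ ∃ B ∈ ℬ, W A ⊆ W B) with hU
    have hUm : ∀ A ∈ U, A ∈ 𝒜 ∧ ∀ B ∈ ℬ, ¬ W A ⊆ W B := by
      intro A h₁
      rw [hU, Finset.mem_filter] at h₁
      push Not at h₁
      exact h₁
    have e₁ : ∑ B ∈ ℬ, B = ∑ w ∈ ℬ.biUnion W, T.label w := by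
      rw [Finset.sum_biUnion fun B h₁ B' h₂ hne => htriples B h₁ B' h₂ hne]
      exact Finset.sum_congr rfl fun B h₁ => (hsumW B (Or.inr h₁)).symm
    have e₂ : ∑ A ∈ U, A = ∑ w ∈ U.biUnion W, T.label w := by
      rw [Finset.sum_biUnion fun A h₁ A' h₂ hne => hpairs A (hUm A h₁).1 A' (hUm A' h₂).1 hne]
      exact Finset.sum_congr rfl fun A h₁ => (hsumW A (Or.inl (hUm A h₁).1)).symm
    have hd : Disjoint (ℬ.biUnion W) (U.biUnion W) := by
      refine (Finset.disjoint_biUnion_left _ _ _).2 fun B h₁ =>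
        (Finset.disjoint_biUnion_right _ _ _).2 fun A h₂ => ?_
      exact (hmixed A (hUm A h₂).1 B h₁ ((hUm A h₂).2 B h₁)).symm
    rw [e₁, e₂, ← Finset.sum_union hd]
    calc _ ≤ ∑ w, T.label w := Finset.sum_le_sum_of_subset (Finset.subset_univ _)
      _ = M := T.m1

end SmallSides

section ParentTrees

/-- The graph joining every vertex to its parent. -/
def parentGraph {V : Type} (par : V → V) : SimpleGraph V :=
  SimpleGraph.fromRel fun u v => par u = v

variable {V : Type} {par : V → V} {r : V}

theorem parentGraph_adj {u v : V} :
    (parentGraph par).Adj u v ↔ u ≠ v ∧ (par u = v ∨ par v = u) := by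
  simp [parentGraph, SimpleGraph.fromRel_adj]

theorem parentGraph_connected (hpp : ∀ v, par (par v) = r) : (parentGraph par).Connected := by
  have hstep : ∀ v, (parentGraph par).Reachable v (par v) := by
    intro v
    by_cases h : v = par v
    · rw [← h]
    · exact SimpleGraph.Adj.reachable (parentGraph_adj.2 ⟨h, Or.inl rfl⟩)
  have hroot : ∀ v, (parentGraph par).Reachable v r := fun v =>
    hpp v ▸ (hstep v).trans (hstep (par v))
  have : Nonempty V := ⟨r⟩
  exact ⟨fun u v => (hroot u).trans (hroot v).symm⟩

/-- Deleting the edge above `v` separates `v` and its children from the other vertices. -/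
theorem parentGraph_reachable_iff (hr : par r = r) (hpp : ∀ v, par (par v) = r)
    (hne : ∀ v, v ≠ r → par v ≠ v) {v w : V} (hv : v ≠ r) :
    ((parentGraph par).deleteEdges {s(v, par v)}).Reachable v w ↔ w = v ∨ par w = v := by
  constructor
  · intro h
    have h' := (SimpleGraph.reachable_iff_reflTransGen v w).1 h
    clear h
    induction h' with
    | refl => exact Or.inl rfl
    | @tail a b _ hab ih =>
      rw [SimpleGraph.deleteEdges_adj, parentGraph_adj, Set.mem_singleton_iff] at hab
      obtain ⟨⟨hab₁, hab₂⟩, hab₃⟩ := hab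
      rcases ih with rfl | h₁
      · rcases hab₂ with rfl | h₂
        · exact absurd rfl hab₃
        · exact Or.inr h₂
      · rcases hab₂ with h₂ | h₂
        · exact Or.inl (h₂.symm.trans h₁)
        · refine absurd ?_ hv
          rw [← h₁, ← h₂, hpp]
  · rintro (rfl | h)
    · exact SimpleGraph.Reachable.refl _
    · have hwr : w ≠ r := fun h' => hv (by rw [← h, h', hr])
      refine SimpleGraph.Adj.reachable ?_
      rw [SimpleGraph.deleteEdges_adj, parentGraph_adj, Set.mem_singleton_iff]
      refine ⟨⟨fun h' => hne w hwr (h.trans h'), Or.inr h⟩, fun he => ?_⟩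
      rcases Sym2.eq_iff.1 he with ⟨-, h'⟩ | ⟨h', -⟩
      · refine hv ?_
        rw [← h, h', hpp]
      · exact hne v hv h'.symm

variable [Fintype V] [DecidableEq V]

theorem parent_edge_injOn (hpp : ∀ v, par (par v) = r) :
    Set.InjOn (fun v => s(v, par v)) ((Finset.univ.erase r : Finset V) : Set V) := by
  intro v hv w _ he
  rcases Sym2.eq_iff.1 he with ⟨h, -⟩ | ⟨h₁, h₂⟩
  · exact h
  · refine absurd ?_ (Finset.ne_of_mem_erase (Finset.mem_coe.1 hv))
    rw [h₁, ← h₂, hpp]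

theorem parentGraph_edgeFinset [Fintype (parentGraph par).edgeSet] (hr : par r = r)
    (hne : ∀ v, v ≠ r → par v ≠ v) :
    (parentGraph par).edgeFinset = (Finset.univ.erase r).image fun v => s(v, par v) := by
  ext e
  induction e using Sym2.ind with
  | _ u v =>
    simp only [SimpleGraph.mem_edgeFinset, SimpleGraph.mem_edgeSet, parentGraph_adj,
      Finset.mem_image, Finset.mem_erase, Finset.mem_univ, and_true]
    constructor
    · rintro ⟨huv, rfl | rfl⟩
      · exact ⟨u, fun h => huv (by rw [h, hr]), rfl⟩
      · exact ⟨v, fun h => huv (by rw [h, hr]), Sym2.eq_swap⟩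
    · rintro ⟨w, hw, he⟩
      rcases Sym2.eq_iff.1 he with ⟨rfl, rfl⟩ | ⟨rfl, rfl⟩
      · exact ⟨(hne w hw).symm, Or.inl rfl⟩
      · exact ⟨hne w hw, Or.inr rfl⟩

theorem parentGraph_isAcyclic (hr : par r = r) (hpp : ∀ v, par (par v) = r)
    (hne : ∀ v, v ≠ r → par v ≠ v) : (parentGraph par).IsAcyclic := by
  refine (SimpleGraph.isTree_iff_connected_and_card.2 ⟨parentGraph_connected hpp, ?_⟩).isAcyclic
  rw [Nat.card_eq_fintype_card, ← SimpleGraph.edgeFinset_card, parentGraph_edgeFinset hr hne,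
    Finset.card_image_of_injOn (parent_edge_injOn hpp), Nat.card_eq_fintype_card,
    Finset.card_erase_add_one (Finset.mem_univ r), Finset.card_univ]

end ParentTrees

section BuildTree

variable {X : Type} {M : Multiset X}

theorem compatible_of_parent_fin {n : ℕ} {r : Fin n} {par : Fin n → Fin n}
    {lab : Fin n → Multiset X} (hr : par r = r) (hpp : ∀ v, par (par v) = r)
    (hne : ∀ v, v ≠ r → par v ≠ v) (hsum : ∑ v, lab v = M) (hlab : ∀ v, v ≠ r → lab v ≠ 0)
    (hroot : lab r = 0 → ((Finset.univ.erase r).filter (fun v => par v = r)).card ≠ 1 ∧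
      ((Finset.univ.erase r).filter (fun v => par v = r)).card ≠ 2) :
    Compatible M ((Finset.univ.erase r).val.map fun v =>
      splitOf M (lab v + ∑ w ∈ Finset.univ.filter (fun w => par w = v), lab w)) := by
  let T : MTree X M :=
    { n := n
      G := parentGraph par
      connected := parentGraph_connected hpp
      acyclic := parentGraph_isAcyclic hr hpp hne
      label := lab
      m1 := hsum
      m2 := by
        intro v hdeg
        by_cases hv : v = r
        · subst hv
          intro h0
          have hN : (parentGraph par).neighborFinset v =
              (Finset.univ.erase v).filter (fun w => par w = v) := by
            ext w
            simp only [SimpleGraph.mem_neighborFinset, parentGraph_adj, Finset.mem_filter,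
              Finset.mem_erase, Finset.mem_univ, and_true, hr]
            constructor
            · rintro ⟨h₁, h₂ | h₂⟩
              · exact absurd h₂ h₁
              · exact ⟨h₁.symm, h₂⟩
            · rintro ⟨h₁, h₂⟩
              exact ⟨h₁.symm, Or.inr h₂⟩
          rw [← SimpleGraph.card_neighborFinset_eq_degree, hN] at hdeg
          have := hroot h0
          tauto
        · exact hlab v hv }
  refine ⟨T, ?_⟩
  have hE : T.G.edgeFinset = (Finset.univ.erase r).image fun v => s(v, par v) :=
    parentGraph_edgeFinset hr hne
  unfold MTree.splits
  rw [hE, Finset.image_val_of_injOn (parent_edge_injOn hpp), Multiset.map_map]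
  refine Multiset.map_congr rfl fun v hv => ?_
  have hv' : v ≠ r := by
    rw [Finset.mem_val] at hv
    exact Finset.ne_of_mem_erase hv
  have hadj : T.G.Adj v (par v) := parentGraph_adj.2 ⟨(hne v hv').symm, Or.inl rfl⟩
  have hpart : T.part v (par v) =
      lab v + ∑ w ∈ Finset.univ.filter (fun w => par w = v), lab w := by
    have hside : T.side v (par v) = insert v (Finset.univ.filter fun w => par w = v) := by
      ext w
      simp only [MTree.side, Finset.mem_filter, Finset.mem_univ, true_and, Finset.mem_insert]
      exact parentGraph_reachable_iff hr hpp hne hv'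
    rw [MTree.part_eq_sum_side, hside, Finset.sum_insert]
    simpa using hne v hv'
  have hother : T.part (par v) v = M - T.part v (par v) :=
    eq_tsub_of_add_eq ((add_comm _ _).trans (T.part_add_part hadj))
  rw [splitOf, ← hpart, ← hother]
  rfl

theorem compatible_of_parent {α : Type} [DecidableEq α] {S : Finset α} {r : α} {par : α → α}
    {lab : α → Multiset X} (hrS : r ∈ S) (hS : ∀ v ∈ S, par v ∈ S) (hr : par r = r)
    (hpp : ∀ v ∈ S, par (par v) = r) (hne : ∀ v ∈ S, v ≠ r → par v ≠ v)
    (hsum : ∑ v ∈ S, lab v = M) (hlab : ∀ v ∈ S, v ≠ r → lab v ≠ 0)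
    (hroot : lab r = 0 → ((S.erase r).filter (fun v => par v = r)).card ≠ 1 ∧
      ((S.erase r).filter (fun v => par v = r)).card ≠ 2) :
    Compatible M ((S.erase r).val.map fun v =>
      splitOf M (lab v + ∑ w ∈ S.filter (fun w => par w = v), lab w)) := by
  obtain ⟨n, g, hg, himg⟩ : ∃ (n : ℕ) (g : Fin n → α), Function.Injective g ∧
      Finset.univ.image g = S := by
    refine ⟨S.card, fun i => (S.equivFin.symm i).1,
      Subtype.val_injective.comp S.equivFin.symm.injective, ?_⟩
    ext v
    simp only [Finset.mem_image, Finset.mem_univ, true_and]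
    exact ⟨fun ⟨i, hi⟩ => hi ▸ (S.equivFin.symm i).2, fun hv => ⟨S.equivFin ⟨v, hv⟩, by simp⟩⟩
  have hgS : ∀ i, g i ∈ S := fun i => himg ▸ Finset.mem_image_of_mem g (Finset.mem_univ i)
  have hSg : ∀ v ∈ S, ∃ i, g i = v := fun v hv => by
    rw [← himg] at hv
    simpa using hv
  obtain ⟨r', hgr⟩ := hSg r hrS
  choose par' hgp using fun i => hSg _ (hS _ (hgS i))
  have hgne : ∀ i, i ≠ r' → g i ≠ r := fun i hi h => hi (hg (h.trans hgr.symm))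
  have himg' : (Finset.univ.erase r').image g = S.erase r := by
    rw [Finset.image_erase hg, himg, hgr]
  have hpar : ∀ i j, par' i = j ↔ par (g i) = g j := fun i j => by
    rw [← hgp]
    exact hg.eq_iff.symm
  have hfilter : ∀ i, (Finset.univ.filter fun j => par' j = i).image g =
      S.filter fun w => par w = g i := by
    intro i
    simp only [hpar]
    rw [← himg, Finset.filter_image]
  have hfilter' : ((Finset.univ.erase r').filter fun j => par' j = r').image g =
      (S.erase r).filter fun w => par w = r := by
    simp only [hpar, hgr]
    rw [← himg', Finset.filter_image]
  have key := compatible_of_parent_fin (M := M) (r := r') (par := par') (lab := fun i => lab (g i))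
    (hg (by rw [hgp, hgr, hr])) (fun v => hg (by rw [hgp, hgp, hpp _ (hgS v), hgr]))
    (fun v hv h => hne _ (hgS v) (hgne v hv) (by rw [← hgp, h]))
    (by rw [← hsum, ← himg, Finset.sum_image hg.injOn])
    (fun v hv => hlab _ (hgS v) (hgne v hv))
    (by
      rw [hgr]
      intro h0
      rw [← Finset.card_image_of_injective _ hg, hfilter']
      exact hroot h0)
  convert key using 1
  rw [← himg', Finset.image_val_of_injOn hg.injOn, Multiset.map_map]
  refine Multiset.map_congr rfl fun i _ => ?_
  simp only [Function.comp]
  rw [← hfilter, Finset.sum_image hg.injOn]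

end BuildTree

namespace SmallSides

variable {X : Type} {M : Multiset X} {𝒜 ℬ : Finset (Multiset X)}

theorem splitOf_injOn (h : SmallSides M 𝒜 ℬ) {C C' : Multiset X} (hC : C ∈ 𝒜 ∨ C ∈ ℬ)
    (hC' : C' ∈ 𝒜 ∨ C' ∈ ℬ) (he : splitOf M C = splitOf M C') : C = C' := by
  rcases Sym2.eq_iff.1 he with ⟨h₁, -⟩ | ⟨h₁, -⟩
  · exact h₁
  · refine h.eq_of_add_eq C C' hC hC' ?_
    rw [h₁, tsub_add_cancel_of_le (h.le_of_mem C' hC')]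

theorem nodup (h : SmallSides M 𝒜 ℬ) :
    (𝒜.val.map (splitOf M) + ℬ.val.map (splitOf M)).Nodup := by
  refine (Multiset.Nodup.add_iff (𝒜.nodup.map_on ?_) (ℬ.nodup.map_on ?_)).2 ?_
  · exact fun C hC C' hC' => h.splitOf_injOn (Or.inl hC) (Or.inl hC')
  · exact fun C hC C' hC' => h.splitOf_injOn (Or.inr hC) (Or.inr hC')
  · refine Multiset.disjoint_left.2 fun {S} h₁ h₂ => ?_
    obtain ⟨A, hA, rfl⟩ := Multiset.mem_map.1 h₁
    obtain ⟨B, hB, he⟩ := Multiset.mem_map.1 h₂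
    have e₁ := h.card_pair A hA
    have e₂ := h.card_triple B hB
    rw [h.splitOf_injOn (Or.inr hB) (Or.inl hA) he] at e₂
    omega

theorem exists_eq_of_le (h : SmallSides M 𝒜 ℬ) {𝔖' : Multiset (Sym2 (Multiset X))}
    (hle : 𝔖' ≤ 𝒜.val.map (splitOf M) + ℬ.val.map (splitOf M)) :
    ∃ 𝒜' ⊆ 𝒜, ∃ ℬ' ⊆ ℬ, 𝔖' = 𝒜'.val.map (splitOf M) + ℬ'.val.map (splitOf M) := by
  have hA := Finset.filter_subset (fun C => splitOf M C ∈ 𝔖') 𝒜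
  have hB := Finset.filter_subset (fun C => splitOf M C ∈ 𝔖') ℬ
  refine ⟨_, hA, _, hB, ?_⟩
  refine (Multiset.Nodup.ext (Multiset.nodup_of_le hle h.nodup) (h.mono hA hB).nodup).2 fun S => ?_
  simp only [Multiset.mem_add, Multiset.mem_map, Finset.mem_val, Finset.mem_filter]
  constructor
  · intro hS
    rcases Multiset.mem_add.1 (Multiset.mem_of_le hle hS) with h' | h'
    · obtain ⟨C, hC, rfl⟩ := Multiset.mem_map.1 h'
      exact Or.inl ⟨C, ⟨hC, hS⟩, rfl⟩
    · obtain ⟨C, hC, rfl⟩ := Multiset.mem_map.1 h'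
      exact Or.inr ⟨C, ⟨hC, hS⟩, rfl⟩
  · rintro (⟨C, ⟨-, hS⟩, rfl⟩ | ⟨C, ⟨-, hS⟩, rfl⟩) <;> exact hS

theorem compatible_of_packable (h : SmallSides M 𝒜 ℬ) (hP : Packable M 𝒜 ℬ) :
    Compatible M (𝒜.val.map (splitOf M) + ℬ.val.map (splitOf M)) := by
  obtain ⟨U, f, hU, hf, hinj, hsum⟩ := hP
  have hAB : Disjoint 𝒜 ℬ := Finset.disjoint_left.2 fun C h₁ h₂ => by
    have e₁ := h.card_pair C h₁
    have e₂ := h.card_triple C h₂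
    omega
  have hcard : ∀ C ∈ 𝒜 ∪ ℬ, 2 ≤ C.card := by
    intro C hC
    rcases Finset.mem_union.1 hC with hC | hC
    · exact (h.card_pair C hC).ge
    · have := h.card_triple C hC
      omega
  have h0 : (0 : Multiset X) ∉ 𝒜 ∪ ℬ := fun hC => by simpa using hcard 0 hC
  have h0A : (0 : Multiset X) ∉ 𝒜 := fun hC => h0 (Finset.mem_union_left _ hC)
  have h0B : (0 : Multiset X) ∉ ℬ := fun hC => h0 (Finset.mem_union_right _ hC)
  have hUB : Disjoint U ℬ := hAB.mono_left hU
  set N := 𝒜 \ U with hN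
  have hNA : N ⊆ 𝒜 := Finset.sdiff_subset
  have hNf : ∀ A ∈ N, f A ∈ ℬ ∧ A ≤ f A := fun A hA =>
    hf A (Finset.mem_sdiff.1 hA).1 (Finset.mem_sdiff.1 hA).2
  set par : Multiset X → Multiset X := fun C => if C ∈ N then f C else 0 with hpar
  have hparN : ∀ C ∈ N, par C = f C := fun C hC => if_pos hC
  have hpar0 : ∀ C, C ∉ N → par C = 0 := fun C hC => if_neg hC
  have hBN : ∀ B ∈ ℬ, B ∉ N := fun B hB hBN => Finset.disjoint_left.1 hAB (hNA hBN) hB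
  set Q : Multiset X → Multiset X := fun C => ∑ A ∈ N.filter (fun A => f A = C), A with hQ
  have hQB : ∀ B ∈ ℬ, Q B ≤ B ∧ (Q B).card ≤ 2 := by
    intro B hB
    rcases (N.filter fun A => f A = B).eq_empty_or_nonempty with he | ⟨A, hA⟩
    · simp [hQ, he]
    · have hsing : N.filter (fun A => f A = B) = {A} := by
        refine Finset.eq_singleton_iff_unique_mem.2 ⟨hA, fun A' hA' => ?_⟩
        obtain ⟨h₁, h₂⟩ := Finset.mem_filter.1 hA
        obtain ⟨h₃, h₄⟩ := Finset.mem_filter.1 hA'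
        rw [hN, Finset.mem_sdiff] at h₁ h₃
        exact hinj A' h₃.1 h₃.2 A h₁.1 h₁.2 (h₄.trans h₂.symm)
      obtain ⟨h₁, h₂⟩ := Finset.mem_filter.1 hA
      simp only [hQ, hsing, Finset.sum_singleton]
      exact ⟨h₂ ▸ (hNf A h₁).2, (h.card_pair A (hNA h₁)).le⟩
  set rest : Multiset X := M - (∑ B ∈ ℬ, B + ∑ A ∈ U, A) with hrest
  set lab : Multiset X → Multiset X := fun C => if C = 0 then rest else C - Q C with hlab
  have hlab0 : lab 0 = rest := if_pos rfl
  have hlabC : ∀ C ∈ 𝒜 ∪ ℬ, lab C = C - Q C := fun C hC => if_neg fun (h' : C = 0) => h0 (h' ▸ hC)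
  have hQA : ∀ A ∈ 𝒜, Q A = 0 := by
    intro A hA
    have : N.filter (fun A' => f A' = A) = ∅ := Finset.filter_eq_empty_iff.2 fun A' hA' he =>
      Finset.disjoint_left.1 hAB hA (he ▸ (hNf A' hA').1)
    simp [hQ, this]
  have hQle : ∀ C ∈ 𝒜 ∪ ℬ, Q C ≤ C := by
    intro C hC
    rcases Finset.mem_union.1 hC with hC | hC
    · simp [hQA C hC]
    · exact (hQB C hC).1
  have hchildren : ∀ C, C ≠ 0 →
      (insert 0 (𝒜 ∪ ℬ)).filter (fun C' => par C' = C) = N.filter fun A => f A = C := by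
    intro C hC
    ext A
    simp only [Finset.mem_filter, Finset.mem_insert]
    constructor
    · rintro ⟨-, h₂⟩
      by_cases hA : A ∈ N
      · exact ⟨hA, (hparN A hA).symm.trans h₂⟩
      · exact absurd ((hpar0 A hA).symm.trans h₂).symm hC
    · rintro ⟨h₁, h₂⟩
      exact ⟨Or.inr (Finset.mem_union_left _ (hNA h₁)), (hparN A h₁).trans h₂⟩
  have hrootChildren : (𝒜 ∪ ℬ).filter (fun C => par C = 0) = U ∪ ℬ := by
    ext C
    simp only [Finset.mem_filter, Finset.mem_union]
    constructor
    · rintro ⟨h₁ | h₁, h₂⟩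
      · by_cases hC : C ∈ N
        · rw [hparN C hC] at h₂
          exact absurd (h₂ ▸ (hNf C hC).1) h0B
        · left
          by_contra hCU
          exact hC (Finset.mem_sdiff.2 ⟨h₁, hCU⟩)
      · exact Or.inr h₁
    · rintro (h₁ | h₁)
      · exact ⟨Or.inl (hU h₁), hpar0 C fun h' => (Finset.mem_sdiff.1 h').2 h₁⟩
      · exact ⟨Or.inr h₁, hpar0 C (hBN C h₁)⟩
  have herase : (insert 0 (𝒜 ∪ ℬ)).erase 0 = 𝒜 ∪ ℬ := Finset.erase_insert h0
  have htotal : ∑ C ∈ insert 0 (𝒜 ∪ ℬ), lab C = M := by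
    have e₁ : ∑ A ∈ 𝒜, lab A = ∑ A ∈ N, A + ∑ A ∈ U, A := by
      rw [hN, Finset.sum_sdiff hU]
      refine Finset.sum_congr rfl fun A hA => ?_
      rw [hlabC A (Finset.mem_union_left _ hA), hQA A hA, tsub_zero]
    have e₂ : ∑ B ∈ ℬ, lab B + ∑ A ∈ N, A = ∑ B ∈ ℬ, B := by
      rw [← Finset.sum_fiberwise_of_maps_to fun A hA => (hNf A hA).1, ← Finset.sum_add_distrib]
      refine Finset.sum_congr rfl fun B hB => ?_
      rw [hlabC B (Finset.mem_union_right _ hB)]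
      exact tsub_add_cancel_of_le (hQB B hB).1
    rw [Finset.sum_insert h0, Finset.sum_union hAB, hlab0, e₁]
    calc _ = rest + ((∑ B ∈ ℬ, lab B + ∑ A ∈ N, A) + ∑ A ∈ U, A) := by abel
      _ = M := by rw [e₂, hrest, tsub_add_cancel_of_le hsum]
  have key := compatible_of_parent (M := M) (S := insert 0 (𝒜 ∪ ℬ)) (r := 0) (par := par)
    (lab := lab) (Finset.mem_insert_self _ _) ?_ (hpar0 0 fun h' => h0A (hNA h')) ?_ ?_ htotal
    ?_ ?_
  · convert key using 1
    rw [herase, ← Finset.disjUnion_eq_union _ _ hAB, Finset.disjUnion_val, ← Multiset.map_add]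
    refine Multiset.map_congr rfl fun C hC => ?_
    have hC' : C ∈ 𝒜 ∪ ℬ := by simpa using hC
    have hne : C ≠ 0 := fun h' => h0 (h' ▸ hC')
    have hsumQ : ∑ A ∈ N.filter (fun A => f A = C), lab A = Q C :=
      Finset.sum_congr rfl fun A hA => by
        have hA' := hNA (Finset.mem_filter.1 hA).1
        rw [hlabC A (Finset.mem_union_left _ hA'), hQA A hA', tsub_zero]
    rw [Finset.disjUnion_eq_union, hchildren C hne, hsumQ, hlabC C hC',
      tsub_add_cancel_of_le (hQle C hC')]
  · intro C _
    by_cases hC : C ∈ N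
    · rw [hparN C hC]
      exact Finset.mem_insert_of_mem (Finset.mem_union_right _ (hNf C hC).1)
    · rw [hpar0 C hC]
      exact Finset.mem_insert_self _ _
  · intro C _
    by_cases hC : C ∈ N
    · rw [hparN C hC]
      exact hpar0 _ (hBN _ (hNf C hC).1)
    · rw [hpar0 C hC]
      exact hpar0 0 fun h' => h0A (hNA h')
  · intro C _ hne
    by_cases hC : C ∈ N
    · rw [hparN C hC]
      exact fun h' => hBN _ (hNf C hC).1 (h'.symm ▸ hC)
    · rw [hpar0 C hC]
      exact hne.symm
  · intro C hC hne
    have hC' : C ∈ 𝒜 ∪ ℬ := (Finset.mem_insert.1 hC).resolve_left hne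
    rw [hlabC C hC', ← Multiset.card_pos, Multiset.card_sub (hQle C hC')]
    rcases Finset.mem_union.1 hC' with hA | hB
    · simp [hQA C hA, h.card_pair C hA]
    · have := hQB C hB
      rw [h.card_triple C hB]
      omega
  · intro hr
    rw [hlab0, hrest, tsub_eq_zero_iff_le] at hr
    have hM : ∑ C ∈ U ∪ ℬ, C = M := by
      rw [Finset.sum_union hUB, add_comm]
      exact le_antisymm hsum hr
    have hmem : ∀ C ∈ U ∪ ℬ, C ∈ 𝒜 ∨ C ∈ ℬ := fun C hC =>
      (Finset.mem_union.1 hC).imp_left (@hU C)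
    rw [herase, hrootChildren]
    constructor
    · intro h₁
      obtain ⟨C, hC⟩ := Finset.card_eq_one.1 h₁
      have hCm := hmem C (hC ▸ Finset.mem_singleton_self C)
      rw [hC, Finset.sum_singleton] at hM
      have e₁ := h.two_mul_card_le C hCm
      have e₂ := hcard C (Finset.mem_union.2 hCm)
      rw [← hM] at e₁
      omega
    · intro h₂
      obtain ⟨C, C', hne, hC⟩ := Finset.card_eq_two.1 h₂
      rw [hC, Finset.sum_pair hne] at hM
      exact hne (h.eq_of_add_eq C C' (hmem C (by simp [hC])) (hmem C' (by simp [hC])) hM)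

theorem compatible_iff (h : SmallSides M 𝒜 ℬ) :
    Compatible M (𝒜.val.map (splitOf M) + ℬ.val.map (splitOf M)) ↔ Packable M 𝒜 ℬ := by
  refine ⟨fun ⟨T, hT⟩ => h.packable_of_mtree T fun C hC => ?_, h.compatible_of_packable⟩
  rw [hT, Multiset.mem_add]
  exact hC.imp (Multiset.mem_map_of_mem _) (Multiset.mem_map_of_mem _)

end SmallSides

theorem exists_small_part {X : Type} {M : Multiset X} {S : Sym2 (Multiset X)} (h : IsSplit M S) :
    ∃ C, S = splitOf M C ∧ C ≤ M ∧ C.card = splitSize S ∧ 2 * C.card ≤ M.card := by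
  obtain ⟨A, B, rfl, -, -, rfl⟩ := h
  have hsize : splitSize s(A, B) = min A.card B.card := rfl
  rcases le_total A.card B.card with hle | hle
  · refine ⟨A, ?_, le_self_add, by rw [hsize, min_eq_left hle], ?_⟩
    · rw [splitOf, add_tsub_cancel_left]
    · rw [Multiset.card_add]
      omega
  · refine ⟨B, ?_, le_add_self, by rw [hsize, min_eq_right hle], ?_⟩
    · rw [splitOf, add_tsub_cancel_right, Sym2.eq_swap]
    · rw [Multiset.card_add]
      omega

theorem exists_smallSides {X : Type} {M : Multiset X} {𝔖 : Multiset (Sym2 (Multiset X))}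
    (hsys : IsSplitSystem M 𝔖) (h23 : ∀ S ∈ 𝔖, splitSize S = 2 ∨ splitSize S = 3)
    (hnodup : 𝔖.Nodup) :
    ∃ 𝒜 ℬ, SmallSides M 𝒜 ℬ ∧ 𝔖 = 𝒜.val.map (splitOf M) + ℬ.val.map (splitOf M) := by
  have hex : ∀ S, ∃ C, S ∈ 𝔖 →
      S = splitOf M C ∧ C ≤ M ∧ C.card = splitSize S ∧ 2 * C.card ≤ M.card := by
    intro S
    by_cases hS : S ∈ 𝔖
    · obtain ⟨C, hC⟩ := exists_small_part (hsys S hS)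
      exact ⟨C, fun _ => hC⟩
    · exact ⟨0, fun h => absurd h hS⟩
  choose P hP using hex
  set family : ℕ → Finset (Multiset X) := fun k =>
    (𝔖.toFinset.filter fun S => splitSize S = k).image P with hfamily
  have hmem : ∀ k, ∀ C ∈ family k, ∃ S ∈ 𝔖, splitSize S = k ∧ P S = C := by
    intro k C hC
    simpa [hfamily, and_assoc] using hC
  have hmem' : ∀ C, C ∈ family 2 ∨ C ∈ family 3 → ∃ S ∈ 𝔖, P S = C := by
    rintro C (hC | hC) <;> obtain ⟨S, hS, -, hSC⟩ := hmem _ C hC <;> exact ⟨S, hS, hSC⟩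
  have hcard : ∀ k, ∀ C ∈ family k, C.card = k := by
    intro k C hC
    obtain ⟨S, hS, rfl, rfl⟩ := hmem k C hC
    exact (hP S hS).2.2.1
  have hsides : SmallSides M (family 2) (family 3) :=
    { card_pair := hcard 2
      card_triple := hcard 3
      le_of_mem := fun C hC => by
        obtain ⟨S, hS, rfl⟩ := hmem' C hC
        exact (hP S hS).2.1
      two_mul_card_le := fun C hC => by
        obtain ⟨S, hS, rfl⟩ := hmem' C hC
        exact (hP S hS).2.2.2
      eq_of_add_eq := fun C C' hC hC' hsum => by
        obtain ⟨S, hS, rfl⟩ := hmem' C hC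
        obtain ⟨S', hS', rfl⟩ := hmem' C' hC'
        congr 1
        rw [(hP S hS).1, (hP S' hS').1, splitOf, splitOf, ← hsum, add_tsub_cancel_left,
          add_tsub_cancel_right, Sym2.eq_swap] }
  refine ⟨family 2, family 3, hsides, (Multiset.Nodup.ext hnodup hsides.nodup).2 fun S => ?_⟩
  simp only [Multiset.mem_add, Multiset.mem_map, Finset.mem_val]
  constructor
  · intro hS
    have hfam : ∀ k, splitSize S = k → P S ∈ family k := fun k hk =>
      Finset.mem_image_of_mem P (by simp [hS, hk])
    exact (h23 S hS).imp (fun h => ⟨P S, hfam 2 h, (hP S hS).1.symm⟩)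
      fun h => ⟨P S, hfam 3 h, (hP S hS).1.symm⟩
  · rw [← exists_or]
    rintro ⟨C, hC⟩
    obtain ⟨S', hS', rfl⟩ := hmem' C (hC.imp And.left And.left)
    have : splitOf M (P S') = S := hC.elim And.right And.right
    rwa [← this, ← (hP S' hS').1]

/-- Theorem. Suppose `𝔖` is a 2,3-split system on `M` in which
every split has multiplicity 1. Then `𝔖` is compatible iff every subset of `𝔖` of
size at most `Δ(M) + 3` is compatible. -/
theorem stmt14 {X : Type} [DecidableEq X] (M : Multiset X)
    (𝔖 : Multiset (Sym2 (Multiset X))) (hsys : IsSplitSystem M 𝔖)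
    (h23 : ∀ S ∈ 𝔖, splitSize S = 2 ∨ splitSize S = 3)
    (hmult : ∀ S ∈ 𝔖, 𝔖.count S = 1) :
    Compatible M 𝔖 ↔
      ∀ 𝔖' : Multiset (Sym2 (Multiset X)), 𝔖' ≤ 𝔖 →
        Multiset.card 𝔖' ≤ delta M + 3 → Compatible M 𝔖' := by
  obtain ⟨𝒜, ℬ, h, rfl⟩ := exists_smallSides hsys h23 (Multiset.nodup_iff_count_eq_one.2 hmult)
  rw [h.compatible_iff]
  constructor
  · intro hP 𝔖' hle _
    obtain ⟨𝒜', hA, ℬ', hB, rfl⟩ := h.exists_eq_of_le hle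
    exact (h.mono hA hB).compatible_iff.2 (hP.mono hA hB)
  · intro hsmall
    refine packable_of_small h.card_pair h.card_triple (fun A hA => h.le_of_mem A (Or.inl hA)) ?_
    intro 𝒜' hA ℬ' hB hcard
    refine (h.mono hA hB).compatible_iff.1 (hsmall _ ?_ ?_)
    · exact add_le_add (Multiset.map_le_map (Finset.val_le_iff.2 hA))
        (Multiset.map_le_map (Finset.val_le_iff.2 hB))
    · simpa using hcard
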